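/- Let φ : ℝⁿ × ℝᵐ → ℝ be C² and concave-convex, and assume its saddle-point set S̄ is nonempty. Then for every solution z(t) of the gradient dynamics and every point w in the ω-limit set of z, the solution of the gradient dynamics starting at w stays at constant distance from every saddle point of φ (i.e. it belongs to S). -/

import Mathlib

open scoped BigOperators

noncomputable section

/-- Points of `ℝⁿ × ℝᵐ`. -/
abbrev Pt (n m : ℕ) := (Fin n → ℝ) × (Fin m → ℝ)

variable {n m : ℕ}

/-- The Euclidean distance on `ℝⁿ × ℝᵐ`. -/
def eDist (a b : Pt n m) : ℝ :=
  Real.sqrt (∑ i, (a.1 i - b.1 i) ^ 2 + ∑ j, (a.2 j - b.2 j) ^ 2)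

/-- The Euclidean inner product on `ℝⁿ × ℝᵐ`. -/
def ip (a b : Pt n m) : ℝ := ∑ i, a.1 i * b.1 i + ∑ j, a.2 j * b.2 j

/-- `φ` is concave-convex: concave in `x` for each fixed `y`, convex in `y` for each fixed `x`. -/
def ConcaveConvex (φ : Pt n m → ℝ) : Prop :=
  (∀ y, ConcaveOn ℝ Set.univ fun x => φ (x, y)) ∧
    (∀ x, ConvexOn ℝ Set.univ fun y => φ (x, y))

/-- `zb` is a saddle point of `φ`. -/
def IsSaddle (φ : Pt n m → ℝ) (zb : Pt n m) : Prop :=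
  ∀ x y, φ (x, zb.2) ≤ φ zb ∧ φ zb ≤ φ (zb.1, y)

/-- The gradient of `φ` in the `x` variables. -/
def gradX (φ : Pt n m → ℝ) (z : Pt n m) : Fin n → ℝ :=
  fun i => fderiv ℝ φ z (Pi.single i 1, 0)

/-- The gradient of `φ` in the `y` variables. -/
def gradY (φ : Pt n m → ℝ) (z : Pt n m) : Fin m → ℝ :=
  fun j => fderiv ℝ φ z (0, Pi.single j 1)

/-- `z : ℝ → ℝⁿ × ℝᵐ` is a (global, C¹) solution of the gradient dynamics
`ẋ = ∇ₓφ, ẏ = -∇_yφ`. -/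
def IsSolution (φ : Pt n m → ℝ) (z : ℝ → Pt n m) : Prop :=
  ∀ t, HasDerivAt z (gradX φ (z t), -gradY φ (z t)) t

/-- `z ∈ 𝒮`: a solution of the gradient dynamics lying at constant distance
from every saddle point. -/
def InS (φ : Pt n m → ℝ) (z : ℝ → Pt n m) : Prop :=
  IsSolution φ z ∧ ∀ zb, IsSaddle φ zb → ∀ t, eDist (z t) zb = eDist (z 0) zb

/-- Second directional derivative of `φ` at `z`, in directions `u` then `v`. -/
def hess (φ : Pt n m → ℝ) (z u v : Pt n m) : ℝ :=
  fderiv ℝ (fun w => fderiv ℝ φ w u) z v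

/-- The `i`th coordinate direction in the `x` variables. -/
def ex (i : Fin n) : Pt n m := (Pi.single i 1, 0)

/-- The `j`th coordinate direction in the `y` variables. -/
def ey (j : Fin m) : Pt n m := (0, Pi.single j 1)

/-- The matrix `A(z) = [[0, φ_{xy}(z)], [-φ_{yx}(z), 0]]`. -/
def matA (φ : Pt n m → ℝ) (z : Pt n m) : Matrix (Fin n ⊕ Fin m) (Fin n ⊕ Fin m) ℝ :=
  Matrix.fromBlocks 0 (Matrix.of fun i j => hess φ z (ex i) (ey j))
    (Matrix.of fun j i => -hess φ z (ey j) (ex i)) 0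

/-- The matrix `B(z) = [[φ_{xx}(z), 0], [0, -φ_{yy}(z)]]`. -/
def matB (φ : Pt n m → ℝ) (z : Pt n m) : Matrix (Fin n ⊕ Fin m) (Fin n ⊕ Fin m) ℝ :=
  Matrix.fromBlocks (Matrix.of fun i i' => hess φ z (ex i) (ex i')) 0 0
    (Matrix.of fun j j' => -hess φ z (ey j) (ey j'))

/-- A point of `ℝⁿ × ℝᵐ` viewed as a vector indexed by `Fin n ⊕ Fin m`. -/
def vec (z : Pt n m) : Fin n ⊕ Fin m → ℝ := Sum.elim z.1 z.2

/-- A vector indexed by `Fin n ⊕ Fin m` viewed as a point of `ℝⁿ × ℝᵐ`. -/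
def unvec (v : Fin n ⊕ Fin m → ℝ) : Pt n m :=
  (fun i => v (Sum.inl i), fun j => v (Sum.inr j))

end

open Set Filter Topology

/-- First-order characterization of convexity: the graph lies above its tangent planes. -/
theorem ConvexOn.add_fderiv_le {E : Type*} [NormedAddCommGroup E] [NormedSpace ℝ E]
    {f : E → ℝ} {f' : E →L[ℝ] ℝ} {x : E} (hf : ConvexOn ℝ univ f) (hf' : HasFDerivAt f f' x)
    (y : E) : f x + f' (y - x) ≤ f y := by
  have hg : ConvexOn ℝ univ (f ∘ AffineMap.lineMap (k := ℝ) x y) := by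
    simpa using hf.comp_affineMap (AffineMap.lineMap (k := ℝ) x y)
  have hd : HasDerivAt (f ∘ AffineMap.lineMap (k := ℝ) x y) (f' (y - x)) 0 := by
    refine HasFDerivAt.comp_hasDerivAt (0 : ℝ) ?_ AffineMap.hasDerivAt_lineMap
    simpa using hf'
  have h := hg.le_slope_of_hasDerivAt (mem_univ 0) (mem_univ 1) one_pos hd
  simp only [slope_def_field, Function.comp_apply, AffineMap.lineMap_apply_one,
    AffineMap.lineMap_apply_zero, sub_zero, div_one] at h
  linarith

/-- Two integral curves of an autonomous vector field separate at most exponentially, in both time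
directions, on a set where the field is Lipschitz. -/
theorem dist_le_mul_exp_abs_of_integralCurves {E : Type*} [NormedAddCommGroup E]
    [NormedSpace ℝ E] {F : E → E} {s : Set E} {K : NNReal} (hF : LipschitzOnWith K F s)
    {f g : ℝ → E} (hf : ∀ t, HasDerivAt f (F (f t)) t) (hg : ∀ t, HasDerivAt g (F (g t)) t)
    {T : ℝ} (hfs : ∀ t, |t| ≤ |T| → f t ∈ s) (hgs : ∀ t, |t| ≤ |T| → g t ∈ s) :
    dist (f T) (g T) ≤ dist (f 0) (g 0) * Real.exp (K * |T|) := by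
  rcases le_total 0 T with hT | hT
  · have hmem : ∀ t ∈ Ico 0 T, |t| ≤ |T| := fun t ht => by
      rw [abs_of_nonneg ht.1, abs_of_nonneg hT]; exact ht.2.le
    have h := dist_le_of_trajectories_ODE_of_mem (v := fun _ => F) (s := fun _ => s)
      (fun _ _ => hF) (fun t _ => (hf t).continuousAt.continuousWithinAt)
      (fun t _ => (hf t).hasDerivWithinAt) (fun t ht => hfs t (hmem t ht))
      (fun t _ => (hg t).continuousAt.continuousWithinAt)
      (fun t _ => (hg t).hasDerivWithinAt) (fun t ht => hgs t (hmem t ht))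
      le_rfl T (right_mem_Icc.2 hT)
    simpa [abs_of_nonneg hT] using h
  · have hmem : ∀ t ∈ Ico 0 (-T), |-t| ≤ |T| := fun t ht => by
      rw [abs_neg, abs_of_nonneg ht.1, abs_of_nonpos hT]; exact ht.2.le
    have hrev : ∀ {h : ℝ → E}, (∀ t, HasDerivAt h (F (h t)) t) →
        ∀ t, HasDerivAt (fun t => h (-t)) (-F (h (-t))) t := fun hh t => by
      simpa [Function.comp_def] using (hh (-t)).scomp t (hasDerivAt_neg t)
    have h := dist_le_of_trajectories_ODE_of_mem (v := fun _ x => -F x) (s := fun _ => s)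
      (fun _ _ => hF.neg) (fun t _ => (hrev hf t).continuousAt.continuousWithinAt)
      (fun t _ => (hrev hf t).hasDerivWithinAt) (fun t ht => hfs (-t) (hmem t ht))
      (fun t _ => (hrev hg t).continuousAt.continuousWithinAt)
      (fun t _ => (hrev hg t).hasDerivWithinAt) (fun t ht => hgs (-t) (hmem t ht))
      le_rfl (-T) (right_mem_Icc.2 (neg_nonneg.2 hT))
    simpa [abs_of_nonpos hT] using h

section GradientDynamics

variable {n m : ℕ} {φ : Pt n m → ℝ}

theorem fderiv_apply_eq_sum_grad (φ : Pt n m → ℝ) (z v : Pt n m) :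
    fderiv ℝ φ z v = ∑ i, v.1 i * gradX φ z i + ∑ j, v.2 j * gradY φ z j := by
  have h1 : (fderiv ℝ φ z).comp (.inl ℝ _ _) v.1 = ∑ i, v.1 i * gradX φ z i := by
    conv_lhs => rw [pi_eq_sum_univ' v.1, map_sum]
    simp [gradX]
  have h2 : (fderiv ℝ φ z).comp (.inr ℝ _ _) v.2 = ∑ j, v.2 j * gradY φ z j := by
    conv_lhs => rw [pi_eq_sum_univ' v.2, map_sum]
    simp [gradY]
  rw [← h1, ← h2]
  simp [← map_add]

/-- The velocity of the gradient dynamics never points away from a saddle point. -/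
theorem IsSaddle.inner_velocity_nonpos (hφ : Differentiable ℝ φ) (hcc : ConcaveConvex φ)
    {zb : Pt n m} (hzb : IsSaddle φ zb) (z : Pt n m) :
    ∑ i, (z.1 i - zb.1 i) * gradX φ z i - ∑ j, (z.2 j - zb.2 j) * gradY φ z j ≤ 0 := by
  have hx : HasFDerivAt (fun x => φ (x, z.2)) ((fderiv ℝ φ z).comp (.inl ℝ _ _)) z.1 :=
    HasFDerivAt.comp (g := φ) z.1 (hφ z).hasFDerivAt (hasFDerivAt_prodMk_left z.1 z.2)
  have hy : HasFDerivAt (fun y => φ (z.1, y)) ((fderiv ℝ φ z).comp (.inr ℝ _ _)) z.2 :=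
    HasFDerivAt.comp (g := φ) z.2 (hφ z).hasFDerivAt (hasFDerivAt_prodMk_right z.1 z.2)
  have h1 := (hcc.1 z.2).neg.add_fderiv_le hx.neg zb.1
  have h2 := (hcc.2 z.1).add_fderiv_le hy zb.2
  have h3 := hzb z.1 z.2
  simp [fderiv_apply_eq_sum_grad] at h1 h2
  have e1 : ∑ i, (z.1 i - zb.1 i) * gradX φ z i = -∑ i, (zb.1 i - z.1 i) * gradX φ z i := by
    rw [← Finset.sum_neg_distrib]; exact Finset.sum_congr rfl fun _ _ => by ring
  have e2 : ∑ j, (z.2 j - zb.2 j) * gradY φ z j = -∑ j, (zb.2 j - z.2 j) * gradY φ z j := by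
    rw [← Finset.sum_neg_distrib]; exact Finset.sum_congr rfl fun _ _ => by ring
  linarith [h3.1, h3.2]

theorem IsSolution.antitone_eDist (hφ : Differentiable ℝ φ) (hcc : ConcaveConvex φ)
    {zb : Pt n m} (hzb : IsSaddle φ zb) {z : ℝ → Pt n m} (hz : IsSolution φ z) :
    Antitone fun t => eDist (z t) zb := by
  have hd : ∀ t, HasDerivAt
      (fun t => ∑ i, ((z t).1 i - zb.1 i) ^ 2 + ∑ j, ((z t).2 j - zb.2 j) ^ 2)
      (2 * (∑ i, ((z t).1 i - zb.1 i) * gradX φ (z t) i -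
        ∑ j, ((z t).2 j - zb.2 j) * gradY φ (z t) j)) t := by
    intro t
    have h1 := hasDerivAt_pi.1 (hz t).fst
    have h2 := hasDerivAt_pi.1 (hz t).snd
    refine ((HasDerivAt.fun_sum fun i _ => ((h1 i).sub_const (zb.1 i)).pow 2).add
      (HasDerivAt.fun_sum fun j _ => ((h2 j).sub_const (zb.2 j)).pow 2)).congr_deriv ?_
    simp [mul_sub (2 : ℝ) (Finset.sum _ _), ← Finset.mul_sum, mul_assoc, ← sub_eq_add_neg]
  have hanti := antitone_of_hasDerivAt_nonpos hd fun t =>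
    mul_nonpos_of_nonneg_of_nonpos zero_le_two (hzb.inner_velocity_nonpos hφ hcc (z t))
  exact fun s t hst => Real.sqrt_le_sqrt (hanti hst)

theorem dist_le_eDist (a b : Pt n m) : dist a b ≤ eDist a b := by
  have hx : 0 ≤ ∑ i, (a.1 i - b.1 i) ^ 2 := Finset.sum_nonneg fun _ _ => sq_nonneg _
  have hy : 0 ≤ ∑ j, (a.2 j - b.2 j) ^ 2 := Finset.sum_nonneg fun _ _ => sq_nonneg _
  refine max_le ((dist_pi_le_iff (Real.sqrt_nonneg _)).2 fun i => ?_)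
    ((dist_pi_le_iff (Real.sqrt_nonneg _)).2 fun j => ?_) <;>
    refine Real.abs_le_sqrt ?_
  · have := Finset.single_le_sum (f := fun i => (a.1 i - b.1 i) ^ 2)
      (fun _ _ => sq_nonneg _) (Finset.mem_univ i)
    linarith
  · have := Finset.single_le_sum (f := fun j => (a.2 j - b.2 j) ^ 2)
      (fun _ _ => sq_nonneg _) (Finset.mem_univ j)
    linarith

theorem continuous_eDist_left (b : Pt n m) : Continuous fun a => eDist a b := by
  unfold eDist
  fun_prop

theorem contDiff_velocity (hφ : ContDiff ℝ 2 φ) :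
    ContDiff ℝ 1 fun z => ((gradX φ z, -gradY φ z) : Pt n m) := by
  have h : ContDiff ℝ 1 (fderiv ℝ φ) := hφ.fderiv_right (by norm_num)
  refine ContDiff.prodMk (contDiff_pi.2 fun i => h.clm_apply contDiff_const)
    (ContDiff.neg (contDiff_pi.2 fun j => h.clm_apply contDiff_const))

/-- Translates of a solution along times at which it approaches `ζ 0` converge to the solution
`ζ`. -/
theorem IsSolution.tendsto_translate (hφ : ContDiff ℝ 2 φ) (hcc : ConcaveConvex φ)
    {zb : Pt n m} (hzb : IsSaddle φ zb) {z ζ : ℝ → Pt n m} (hz : IsSolution φ z)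
    (hζ : IsSolution φ ζ) {tk : ℕ → ℝ} (htk : Tendsto tk atTop atTop)
    (hlim : Tendsto (fun k => z (tk k)) atTop (𝓝 (ζ 0))) (T : ℝ) :
    Tendsto (fun k => z (tk k + T)) atTop (𝓝 (ζ T)) := by
  have hζc : Continuous ζ := continuous_iff_continuousAt.2 fun t => (hζ t).continuousAt
  obtain ⟨R, hR⟩ := ((isCompact_Icc (a := -|T|) (b := |T|)).image hζc).isBounded.subset_closedBall
    zb
  set s := Metric.closedBall zb (max R (eDist (z 0) zb)) with hs
  obtain ⟨K, hK⟩ := (contDiff_velocity hφ).contDiffOn.exists_lipschitzOnWith one_ne_zero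
    (convex_closedBall zb _) (isCompact_closedBall zb (max R (eDist (z 0) zb)))
  have hζs : ∀ t, |t| ≤ |T| → ζ t ∈ s := fun t ht =>
    Metric.closedBall_subset_closedBall (le_max_left _ _) (hR ⟨t, abs_le.1 ht, rfl⟩)
  have hzs : ∀ t, 0 ≤ t → z t ∈ s := fun t ht => Metric.mem_closedBall.2 <|
    (dist_le_eDist _ _).trans <|
      (hz.antitone_eDist (hφ.differentiable two_ne_zero) hcc hzb ht).trans (le_max_right _ _)
  have hbound : ∀ᶠ k in atTop,
      dist (z (tk k + T)) (ζ T) ≤ dist (z (tk k)) (ζ 0) * Real.exp (K * |T|) := by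
    filter_upwards [htk.eventually_ge_atTop |T|] with k hk
    have h := dist_le_mul_exp_abs_of_integralCurves hK (f := fun t => z (tk k + t)) (T := T)
      (fun t => (hz (tk k + t)).comp_const_add (tk k) t) hζ
      (fun t ht => hzs _ (by linarith [neg_abs_le t])) hζs
    simpa using h
  rw [tendsto_iff_dist_tendsto_zero] at hlim ⊢
  refine squeeze_zero' (Eventually.of_forall fun _ => dist_nonneg) hbound ?_
  simpa using hlim.mul_const (Real.exp (K * |T|))

end GradientDynamics

/-- If `φ` is `C²` concave-convex with a nonempty saddle set, then for any
solution `z` of the gradient dynamics and any point `w` of its ω-limit set, the solution of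
the gradient dynamics starting at `w` lies at constant distance from every saddle point. -/
theorem omega_limit_in_S {n m : ℕ} (φ : Pt n m → ℝ)
    (hφ : ContDiff ℝ 2 φ) (hcc : ConcaveConvex φ)
    (hsaddle : ∃ zb, IsSaddle φ zb)
    (z : ℝ → Pt n m) (hz : IsSolution φ z) (w : Pt n m)
    (hw : ∃ tk : ℕ → ℝ, Filter.Tendsto tk Filter.atTop Filter.atTop ∧
      Filter.Tendsto (fun k => z (tk k)) Filter.atTop (nhds w))
    (ζ : ℝ → Pt n m) (hζ : IsSolution φ ζ) (hζ0 : ζ 0 = w) :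
    InS φ ζ := by
  obtain ⟨tk, htk, hlim⟩ := hw
  subst hζ0
  refine ⟨hζ, fun zb hzb t => ?_⟩
  have hL := tendsto_atTop_ciInf (hz.antitone_eDist (hφ.differentiable two_ne_zero) hcc hzb)
    ⟨0, forall_mem_range.2 fun _ => Real.sqrt_nonneg _⟩
  have key : ∀ T, eDist (ζ T) zb = ⨅ t, eDist (z t) zb := fun T =>
    tendsto_nhds_unique
      (((continuous_eDist_left zb).tendsto _).comp
        (hz.tendsto_translate hφ hcc hzb hζ htk hlim T))
      (hL.comp (tendsto_atTop_add_const_right atTop T htk))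
  rw [key t, key 0]
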